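/- ζ''(0) = γ_1 + γ^2/2 - π^2/24 - (1/2) log^2(2π), where γ is the Euler–Mascheroni constant and γ_1 is the first Stieltjes constant. -/

import Mathlib

open Filter Topology

/-- The second-order Leibniz rule. -/
lemma iteratedDeriv_two_mul {f g : ℂ → ℂ} {x : ℂ} (hf : AnalyticAt ℂ f x)
    (hg : AnalyticAt ℂ g x) :
    iteratedDeriv 2 (f * g) x =
      iteratedDeriv 2 f x * g x + 2 * deriv f x * deriv g x + f x * iteratedDeriv 2 g x := by
  rw [iteratedDeriv_mul hf.contDiffAt hg.contDiffAt]
  simp [Finset.sum_range_succ, iteratedDeriv_one]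
  ring

/-- The third derivative at `0` of `f * sin (c ·)`, which does not involve that of `f`. -/
lemma iteratedDeriv_three_mul_sin {f : ℂ → ℂ} (hf : AnalyticAt ℂ f 0) (c : ℂ) :
    iteratedDeriv 3 (f * fun t ↦ Complex.sin (c * t)) 0 =
      3 * c * iteratedDeriv 2 f 0 - c ^ 3 * f 0 := by
  have hs : AnalyticAt ℂ (fun t ↦ Complex.sin (c * t)) 0 := by fun_prop
  have h2 : iteratedDeriv 2 Complex.sin = -Complex.sin := by
    simpa using Complex.iteratedDeriv_even_sin 1
  have h3 : iteratedDeriv 3 Complex.sin = -Complex.cos := by simp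
  rw [iteratedDeriv_mul hf.contDiffAt hs.contDiffAt]
  simp [Finset.sum_range_succ, iteratedDeriv_comp_const_mul Complex.contDiff_sin, h2, h3,
    Nat.choose]
  ring

/-- The third derivative at `0` of `t ↦ t * f t`. -/
lemma iteratedDeriv_three_mul_id {f : ℂ → ℂ} (hf : AnalyticAt ℂ f 0) :
    iteratedDeriv 3 (f * id) 0 = 3 * iteratedDeriv 2 f 0 := by
  rw [iteratedDeriv_mul hf.contDiffAt contDiffAt_id]
  simp [Finset.sum_range_succ, iteratedDeriv_id, Nat.choose]

lemma Complex.analyticAt_Gamma_one_add_zero : AnalyticAt ℂ (fun t ↦ Complex.Gamma (1 + t)) 0 := by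
  have h : AnalyticAt ℂ Complex.Gamma (1 + 0) := by
    refine DifferentiableOn.analyticAt (s := {z : ℂ | 0 < z.re}) (fun z hz ↦ ?_)
      ((isOpen_lt continuous_const Complex.continuous_re).mem_nhds (by simp))
    refine (Complex.differentiableAt_Gamma z fun m hm ↦ ?_).differentiableWithinAt
    have : (0 : ℝ) < -m := by simpa [hm] using hz
    have := m.cast_nonneg (α := ℝ)
    linarith
  exact h.fun_comp (by fun_prop)

lemma Complex.deriv_Gamma_one_add_zero :
    deriv (fun t ↦ Complex.Gamma (1 + t)) 0 = -Real.eulerMascheroniConstant := by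
  simp [deriv_comp_const_add, Complex.hasDerivAt_Gamma_one.deriv]

/-- Euler's reflection formula in a form without poles near `0`. -/
lemma Complex.Gamma_one_add_mul_Gamma_one_sub_mul_sin {t : ℂ} (ht : ‖t‖ < 1) :
    Complex.Gamma (1 + t) * Complex.Gamma (1 - t) * Complex.sin (Real.pi * t) = Real.pi * t := by
  rcases eq_or_ne t 0 with rfl | h0
  · simp
  have hsin : Complex.sin (Real.pi * t) ≠ 0 := by
    rw [Complex.sin_ne_zero_iff]
    intro k hk
    rw [mul_comm, mul_left_inj' (by simp)] at hk
    subst hk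
    rw [Complex.norm_intCast] at ht
    exact h0 (by exact_mod_cast Int.abs_lt_one_iff.mp (by exact_mod_cast ht))
  rw [add_comm, Complex.Gamma_add_one t h0, mul_assoc t, Complex.Gamma_mul_Gamma_one_sub]
  rw [← mul_div_assoc, div_mul_cancel₀ _ hsin, mul_comm]

/-- `Γ''(1) = γ² + π² / 6`. -/
lemma Complex.iteratedDeriv_two_Gamma_one_add_zero :
    iteratedDeriv 2 (fun t ↦ Complex.Gamma (1 + t)) 0 =
      (Real.eulerMascheroniConstant : ℂ) ^ 2 + (Real.pi : ℂ) ^ 2 / 6 := by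
  set G : ℂ → ℂ := fun t ↦ Complex.Gamma (1 + t) with hG
  have hGa : AnalyticAt ℂ G 0 := Complex.analyticAt_Gamma_one_add_zero
  have hHa : AnalyticAt ℂ (fun t ↦ G (-t)) 0 :=
    AnalyticAt.fun_comp (f := fun t : ℂ ↦ -t) (by simpa using hGa) (by fun_prop)
  have key : (G * (fun t ↦ G (-t))) * (fun t ↦ Complex.sin (Real.pi * t)) =ᶠ[𝓝 0]
      (fun _ ↦ (Real.pi : ℂ)) * id := by
    filter_upwards [Metric.ball_mem_nhds (0 : ℂ) one_pos] with t ht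
    simpa [hG, sub_eq_add_neg] using
      Complex.Gamma_one_add_mul_Gamma_one_sub_mul_sin (by simpa using ht)
  have h := key.iteratedDeriv_eq 3
  rw [iteratedDeriv_three_mul_sin (hGa.mul hHa), iteratedDeriv_three_mul_id analyticAt_const,
    iteratedDeriv_two_mul hGa hHa, iteratedDeriv_comp_neg, deriv_comp_neg,
    neg_zero, show deriv G 0 = _ from Complex.deriv_Gamma_one_add_zero,
    show G 0 = 1 by simp [hG]] at h
  simp [iteratedDeriv_const, hG] at h
  have hpi : (Real.pi : ℂ) ≠ 0 := by simp
  apply mul_left_cancel₀ hpi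
  linear_combination h / 6

/-- The functional equation of `ζ` near `0`, in a form without poles. -/
lemma riemannZeta_neg_mul_self {t : ℂ} (ht : ‖t‖ < 1) :
    riemannZeta (-t) * t = -(Real.pi : ℂ)⁻¹ *
      (Complex.exp (-(Real.log (2 * Real.pi) : ℂ) * t) * Complex.Gamma (1 + t) *
        riemannZeta₁ (1 + t) * Complex.sin (Real.pi / 2 * t)) := by
  rcases eq_or_ne t 0 with rfl | h0
  · simp
  have hs (n : ℕ) : 1 + t ≠ -n := by
    intro h
    have hre : 1 + t.re = -n := by simpa using congrArg Complex.re h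
    have := n.cast_nonneg (α := ℝ)
    have := neg_abs_le t.re
    have := Complex.abs_re_le_norm t
    linarith
  have h := riemannZeta_one_sub hs (by simpa using h0)
  have hpi : (Real.pi : ℂ) ≠ 0 := by simp
  have hcos : Complex.cos (Real.pi * (1 + t) / 2) = -Complex.sin (Real.pi / 2 * t) := by
    rw [← Complex.cos_add_pi_div_two]
    ring_nf
  have hpow : (2 * Real.pi : ℂ) ^ (-(1 + t)) =
      (2 * Real.pi : ℂ)⁻¹ * Complex.exp (-(Real.log (2 * Real.pi) : ℂ) * t) := by
    rw [neg_add, Complex.cpow_add _ _ (by simp), Complex.cpow_neg_one,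
      Complex.cpow_def_of_ne_zero (by simp), Complex.ofReal_log (by positivity)]
    push_cast
    ring_nf
  rw [hcos, hpow, riemannZeta_eq_inv_sub_mul (s := 1 + t) (by simpa using h0),
    show 1 - (1 + t) = -t by ring, show 1 + t - 1 = t by ring] at h
  rw [h]
  field_simp

/-- The derivative at `1` of the regular part of `ζ` in terms of its Laurent coefficients. -/
lemma deriv_riemannZeta₀_one (γs : ℕ → ℂ)
    (hγs : ∀ᶠ s in 𝓝[≠] (1 : ℂ),
      HasSum (fun n : ℕ => ((-1) ^ n / (n.factorial : ℂ)) * γs n * (s - 1) ^ n)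
        (riemannZeta s - 1 / (s - 1))) :
    deriv riemannZeta₀ 1 = -γs 1 := by
  classical
  let p := FormalMultilinearSeries.ofScalars ℂ fun n : ℕ ↦ (-1) ^ n / (n.factorial : ℂ) * γs n
  have hp (n : ℕ) : p.coeff n = (-1) ^ n / (n.factorial : ℂ) * γs n := by
    simp [p, FormalMultilinearSeries.coeff_ofScalars]
  have hf : HasFPowerSeriesAt (Function.update riemannZeta₀ 1 (γs 0)) p 1 := by
    rw [hasFPowerSeriesAt_iff']
    filter_upwards [eventually_nhdsWithin_iff.1 hγs] with s hs
    rcases eq_or_ne s 1 with rfl | h1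
    · simpa [hp] using hasSum_single (f := fun n : ℕ ↦ ((1 : ℂ) - 1) ^ n • p.coeff n) 0
        (by simp +contextual)
    · simpa [hp, h1, riemannZeta₀, mul_comm] using hs h1
  have heq : Function.update riemannZeta₀ 1 (γs 0) =ᶠ[𝓝 1] riemannZeta₀ := by
    rw [← hf.analyticAt.continuousAt.eventuallyEq_nhds_iff_eventuallyEq_nhdsNE
      differentiable_riemannZeta₀.continuous.continuousAt]
    filter_upwards [self_mem_nhdsWithin] with s hs using Function.update_of_ne hs _ _
  rw [← heq.deriv_eq, hf.deriv]
  exact (hp 1).trans (by simp)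

lemma iteratedDeriv_two_riemannZeta₁_one :
    iteratedDeriv 2 riemannZeta₁ 1 = 2 * deriv riemannZeta₀ 1 := by
  have h : deriv riemannZeta₁ = fun s ↦ riemannZeta₀ s + (s - 1) * deriv riemannZeta₀ s := by
    ext s
    unfold riemannZeta₁
    rw [deriv_const_add, deriv_fun_mul (by fun_prop) (by fun_prop)]
    simp
  have hd : Differentiable ℂ (deriv riemannZeta₀) := differentiable_riemannZeta₀.deriv
  rw [iteratedDeriv_succ, iteratedDeriv_one, h, deriv_fun_add (by fun_prop) (by fun_prop),
    deriv_fun_mul (by fun_prop) (by fun_prop)]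
  simp only [sub_self, zero_mul, add_zero, deriv_sub_const, deriv_id'', one_mul]
  ring

/-- `ζ''(0) = γ₁ + γ²/2 - π²/24 - (1/2) log²(2π)`, where `γs 1` is the first
Stieltjes constant (defined via the Laurent expansion of `ζ` at `s = 1`) and
`γ` is the Euler–Mascheroni constant. -/
theorem zeta_second_deriv_at_zero (γs : ℕ → ℂ)
    (hγs : ∀ᶠ s in nhdsWithin (1 : ℂ) {(1 : ℂ)}ᶜ,
      HasSum (fun n : ℕ => ((-1) ^ n / (n.factorial : ℂ)) * γs n * (s - 1) ^ n)
        (riemannZeta s - 1 / (s - 1))) :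
    iteratedDeriv 2 riemannZeta 0 =
      γs 1 + (Real.eulerMascheroniConstant : ℂ) ^ 2 / 2 - (Real.pi : ℂ) ^ 2 / 24
        - (Real.log (2 * Real.pi) : ℂ) ^ 2 / 2 := by
  set L : ℂ := (Real.log (2 * Real.pi) : ℂ)
  let E : ℂ → ℂ := fun t ↦ Complex.exp (-L * t)
  let G : ℂ → ℂ := fun t ↦ Complex.Gamma (1 + t)
  let Z : ℂ → ℂ := fun t ↦ riemannZeta₁ (1 + t)
  have hE : AnalyticAt ℂ E 0 := by fun_prop
  have hG : AnalyticAt ℂ G 0 := Complex.analyticAt_Gamma_one_add_zero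
  have hZ : AnalyticAt ℂ Z 0 := by
    have : Differentiable ℂ Z := by fun_prop
    exact this.analyticAt 0
  have hF : AnalyticAt ℂ (fun t ↦ riemannZeta (-t)) 0 := by
    have h : AnalyticAt ℂ riemannZeta (-0) := by
      refine DifferentiableOn.analyticAt (s := {1}ᶜ)
        (fun z hz ↦ (differentiableAt_riemannZeta hz).differentiableWithinAt)
        (isOpen_compl_singleton.mem_nhds (by simp))
    exact h.fun_comp (by fun_prop)
  have key : (fun t ↦ riemannZeta (-t)) * id =ᶠ[𝓝 0]
      fun t ↦ -(Real.pi : ℂ)⁻¹ * (E * G * Z * fun t ↦ Complex.sin (Real.pi / 2 * t)) t := by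
    filter_upwards [Metric.ball_mem_nhds (0 : ℂ) one_pos] with t ht
    exact riemannZeta_neg_mul_self (by simpa using ht)
  have h := key.iteratedDeriv_eq 3
  have hE1 : deriv E 0 = -L := by
    simpa [E] using congrFun (iteratedDeriv_cexp_const_mul 1 (-L)) 0
  have hE2 : iteratedDeriv 2 E 0 = L ^ 2 := by
    simpa [E] using congrFun (iteratedDeriv_cexp_const_mul 2 (-L)) 0
  have hG1 : deriv G 0 = _ := Complex.deriv_Gamma_one_add_zero
  have hG2 : iteratedDeriv 2 G 0 = _ := Complex.iteratedDeriv_two_Gamma_one_add_zero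
  have hZ1 : deriv Z 0 = Real.eulerMascheroniConstant := by
    simp [Z, deriv_comp_const_add]
  have hZ2 : iteratedDeriv 2 Z 0 = 2 * -γs 1 := by
    simp [Z, iteratedDeriv_comp_const_add, iteratedDeriv_two_riemannZeta₁_one,
      deriv_riemannZeta₀_one γs hγs]
  rw [iteratedDeriv_three_mul_id hF, iteratedDeriv_comp_neg, iteratedDeriv_const_mul_field,
    iteratedDeriv_three_mul_sin ((hE.mul hG).mul hZ), iteratedDeriv_two_mul (hE.mul hG) hZ,
    iteratedDeriv_two_mul hE hG, deriv_mul hE.differentiableAt hG.differentiableAt,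
    hE1, hE2, hG1, hG2, hZ1, hZ2] at h
  have hpi : (Real.pi : ℂ) ≠ 0 := by simp
  simp [E, G, Z] at h
  field_simp at h ⊢
  linear_combination h / 3
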